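/- Let A be an abelian category with derived category D(A). Let Q be an object of D(A), u : Q → Q a nilpotent endomorphism, and suppose there is a distinguished triangle Q →^u Q → X → Q⟦1⟧ where Hⁱ(X) = 0 for all i ≠ 0. Then X ≅ 0 (equivalently H⁰(X) = 0). In other words, no nonzero stalk complex is the cone of a nilpotent endomorphism in D(A): no nonzero object of the heart satisfies 0 ≤_{Δ+nil} X. -/

import Mathlib

open CategoryTheory Category Limits Pretriangulated

/-- An endomorphism `u` of `Q` is nilpotent if some positive power of it
(in the endomorphism ring `End Q`) vanishes. -/
def IsNilpotentEndo {T : Type*} [Category T] [Preadditive T] {Q : T} (u : Q ⟶ Q) : Prop :=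
  ∃ n : ℕ, 0 < n ∧ (show End Q from u) ^ n = 0

/-- An object with a nilpotent endomorphism that is a monomorphism or an epimorphism is zero. -/
lemma IsNilpotentEndo.isZero_of_mono_or_epi {T : Type*} [Category T] [Preadditive T] {Q : T}
    {u : Q ⟶ Q} (hu : IsNilpotentEndo u) (h : Mono u ∨ Epi u) : IsZero Q := by
  obtain ⟨n, -, hn⟩ := hu
  rw [IsZero.iff_id_eq_zero]
  change (1 : End Q) = 0
  induction n with
  | zero => simpa using hn
  | succ n ih =>
    refine ih ?_
    rcases h with h | h
    · rw [pow_succ'] at hn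
      rw [← cancel_mono u]
      exact hn.trans zero_comp.symm
    · rw [pow_succ] at hn
      rw [← cancel_epi u]
      exact hn.trans comp_zero.symm

/-- Functors preserving zero morphisms preserve nilpotent endomorphisms. -/
lemma IsNilpotentEndo.map {T S : Type*} [Category T] [Preadditive T] [Category S] [Preadditive S]
    {Q : T} {u : Q ⟶ Q} (hu : IsNilpotentEndo u) (F : T ⥤ S) [F.PreservesZeroMorphisms] :
    IsNilpotentEndo (F.map u) := by
  obtain ⟨n, hn, h⟩ := hu
  exact ⟨n, hn, (map_pow (F.mapEnd Q) (show End Q from u) n).symm.trans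
    ((congrArg F.map h).trans (F.map_zero Q Q))⟩

/-- in the derived category of an abelian category `A`, if `X` is the
cone of a nilpotent endomorphism `u : Q ⟶ Q` (distinguished triangle
`Q →^u Q → X → Q⟦1⟧`) and `Hⁱ(X) = 0` for all `i ≠ 0`, then `X ≅ 0`: no nonzero
object of the heart satisfies `0 ≤_{Δ+nil} X`. -/
theorem stmt13 {A : Type*} [Category A] [Abelian A] [HasDerivedCategory A]
    (Q X : DerivedCategory A) (u : Q ⟶ Q) (hu : IsNilpotentEndo u)
    (g : Q ⟶ X) (h : X ⟶ Q⟦(1 : ℤ)⟧)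
    (hT : Triangle.mk u g h ∈ distTriang (DerivedCategory A))
    (hX : ∀ i : ℤ, i ≠ 0 → IsZero ((DerivedCategory.homologyFunctor A i).obj X)) :
    IsZero X := by
  have hQ (i : ℤ) : IsZero ((DerivedCategory.homologyFunctor A i).obj Q) := by
    refine (hu.map (DerivedCategory.homologyFunctor A i)).isZero_of_mono_or_epi ?_
    by_cases hi : i = 0
    · subst hi
      exact Or.inl ((DerivedCategory.HomologySequence.mono_homologyMap_mor₁_iff
        _ hT (-1) 0 (by lia)).2 ((hX (-1) (by lia)).eq_of_src _ _))
    · exact Or.inr ((DerivedCategory.HomologySequence.epi_homologyMap_mor₁_iff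
        _ hT i).2 ((hX i hi).eq_of_tgt _ _))
  have : IsIso u := (DerivedCategory.isIso_iff A u).2 fun i =>
    (hQ i).isIso (hQ i) _
  exact (Triangle.isZero₃_iff_isIso₁ _ hT).2 this
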